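/- Define T̃_{ψ,z}(a) := Σ_{s∈S} a_s F_{s,z} for a = {a_s}_{s∈S}, where F_{s,z} := ψ(z,s) h_{s,z}², h_{s,z} := T_{ψ,z}(e_s), and T_{ψ,z} is an interpolation operator of norm c for p = 2. Then T̃_{ψ,z} maps l_{∞,ψ,z}(M') boundedly into H_{∞,ψ}(M') with norm at most c², and (T̃_{ψ,z} a)(z,t) = a(z,t) for all t ∈ S; i.e. T̃_{ψ,z} is a bounded linear interpolation operator for p = ∞. -/

import Mathlib

open Set
open scoped Manifold Topology ENNReal NNReal Classical

noncomputable section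

/-- The weighted `ℓ^p` norm of `g` on the fibre `r ⁻¹' {x}` of a covering `r : N' → N`
(the norm of the space `l_{p,ψ,x}`). -/
def fibLpNorm {N N' : Type*} (r : N' → N) (ψ : N' → ℝ) (p : ℝ≥0∞) (x : N)
    (g : N' → ℂ) : ℝ :=
  if p = ∞ then ⨆ y : r ⁻¹' {x}, ‖g ↑y‖ * ψ ↑y
  else (∑' y : r ⁻¹' {x}, ‖g ↑y‖ ^ p.toReal * ψ ↑y) ^ (1 / p.toReal)

/-- Membership in the space `l_{p,ψ,x}` of the fibre over `x`. -/
def MemFibLp {N N' : Type*} (r : N' → N) (ψ : N' → ℝ) (p : ℝ≥0∞) (x : N)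
    (g : N' → ℂ) : Prop :=
  if p = ∞ then BddAbove (range fun y : r ⁻¹' {x} => ‖g ↑y‖ * ψ ↑y)
  else Summable fun y : r ⁻¹' {x} => ‖g ↑y‖ ^ p.toReal * ψ ↑y

/-- The norm of the space `H_{p,ψ}(M')`: the sup over `x ∈ M` of the weighted `ℓ^p`
norms over the fibres `r ⁻¹' {x}`. -/
def covHpNorm {N N' : Type*} (r : N' → N) (ψ : N' → ℝ) (p : ℝ≥0∞) (M : Set N)
    (g : N' → ℂ) : ℝ :=
  ⨆ x : M, fibLpNorm r ψ p ↑x g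

/-- Membership in the space `H_{p,ψ}(M')` : `g` is holomorphic on `M' := r ⁻¹' M`,
its restriction to every fibre lies in `l_{p,ψ,x}`, and its `H_{p,ψ}` norm is finite. -/
def MemCovHp (H : Type*) [NormedAddCommGroup H] [NormedSpace ℂ H]
    {N N' : Type*} [TopologicalSpace N] [ChartedSpace H N]
    [TopologicalSpace N'] [ChartedSpace H N']
    (r : N' → N) (ψ : N' → ℝ) (p : ℝ≥0∞) (M : Set N) (g : N' → ℂ) : Prop :=
  MDifferentiableOn 𝓘(ℂ, H) 𝓘(ℂ, ℂ) g (r ⁻¹' M) ∧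
  (∀ x ∈ M, MemFibLp r ψ p x g) ∧
  BddAbove (range fun x : M => fibLpNorm r ψ p ↑x g)

/-- A relatively compact domain `M ⊂⊂ N` with smooth boundary which is strongly
pseudoconvex: `M = {ρ < 0}` for a `C²` function `ρ` defined near `closure M` with
`dρ ≠ 0` on the boundary, whose Levi form is positive on the complex tangent space
of the boundary.  (In a chart, the Levi form applied to `w` equals
`(1/4)(Hess ρ (w,w) + Hess ρ (i•w, i•w))`, and the complex tangency of `w` means
`dρ(w) = dρ(i•w) = 0`.) -/
def IsStronglyPseudoconvexDomain (H : Type*) [NormedAddCommGroup H] [NormedSpace ℂ H]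
    {N : Type*} [TopologicalSpace N] [ChartedSpace H N] (M : Set N) : Prop :=
  IsOpen M ∧ IsConnected M ∧ IsCompact (closure M) ∧
  ∃ (Ω : Set N) (ρ : N → ℝ), IsOpen Ω ∧ closure M ⊆ Ω ∧
    M = {z ∈ Ω | ρ z < 0} ∧
    (∀ z ∈ Ω, ContDiffAt ℝ 2 (fun u => ρ ((chartAt H z).symm u)) (chartAt H z z)) ∧
    (∀ z ∈ frontier M, fderiv ℝ (fun u => ρ ((chartAt H z).symm u)) (chartAt H z z) ≠ 0) ∧
    (∀ z ∈ frontier M, ∀ w : H, w ≠ 0 →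
      fderiv ℝ (fun u => ρ ((chartAt H z).symm u)) (chartAt H z z) w = 0 →
      fderiv ℝ (fun u => ρ ((chartAt H z).symm u)) (chartAt H z z) ((Complex.I : ℂ) • w) = 0 →
      0 < fderiv ℝ (fun u => fderiv ℝ (fun v => ρ ((chartAt H z).symm v)) u w)
            (chartAt H z z) w +
          fderiv ℝ (fun u => fderiv ℝ (fun v => ρ ((chartAt H z).symm v)) u
            ((Complex.I : ℂ) • w)) (chartAt H z z) ((Complex.I : ℂ) • w))

/-- An open subset which is a Stein manifold: it is holomorphically separable and
holomorphically convex (every compact subset has compact holomorphically convex hull). -/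
def IsSteinOpen (H : Type*) [NormedAddCommGroup H] [NormedSpace ℂ H]
    {N : Type*} [TopologicalSpace N] [ChartedSpace H N] (Ω : Set N) : Prop :=
  IsOpen Ω ∧
  (∀ x ∈ Ω, ∀ y ∈ Ω, x ≠ y →
    ∃ f : N → ℂ, MDifferentiableOn 𝓘(ℂ, H) 𝓘(ℂ, ℂ) f Ω ∧ f x ≠ f y) ∧
  (∀ K : Set N, K ⊆ Ω → IsCompact K →
    IsCompact {x ∈ Ω | ∀ f : N → ℂ, MDifferentiableOn 𝓘(ℂ, H) 𝓘(ℂ, ℂ) f Ω →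
      ‖f x‖ ≤ ⨆ y : K, ‖f ↑y‖})

/-- A holomorphically convex open subset: the holomorphically convex hull (with respect
to functions holomorphic on `V`) of every compact subset of `V` is compact. -/
def IsHolomorphicallyConvexOpen (H : Type*) [NormedAddCommGroup H] [NormedSpace ℂ H]
    {N : Type*} [TopologicalSpace N] [ChartedSpace H N] (V : Set N) : Prop :=
  IsOpen V ∧
  (∀ K : Set N, K ⊆ V → IsCompact K →
    IsCompact {x ∈ V | ∀ f : N → ℂ, MDifferentiableOn 𝓘(ℂ, H) 𝓘(ℂ, ℂ) f V →
      ‖f x‖ ≤ ⨆ y : K, ‖f ↑y‖})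

/-- A compact subset which is holomorphically convex in `M`: it coincides with its
holomorphically convex hull with respect to functions holomorphic on `M`. -/
def IsHolConvexCompactIn (H : Type*) [NormedAddCommGroup H] [NormedSpace ℂ H]
    {N : Type*} [TopologicalSpace N] [ChartedSpace H N] (M K : Set N) : Prop :=
  IsCompact K ∧ K ⊆ M ∧
  {x ∈ M | ∀ f : N → ℂ, MDifferentiableOn 𝓘(ℂ, H) 𝓘(ℂ, ℂ) f M →
    ‖f x‖ ≤ ⨆ y : K, ‖f ↑y‖} ⊆ K

/-- A compact complex subvariety of `M` of complex dimension `≥ 1`: a nonempty compact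
subset of `M`, without isolated points (which for analytic sets is equivalent to having
positive dimension at each point), which is locally the common zero set of a family of
holomorphic functions. -/
def IsCompactPosDimSubvariety (H : Type*) [NormedAddCommGroup H] [NormedSpace ℂ H]
    {N : Type*} [TopologicalSpace N] [ChartedSpace H N] (M A : Set N) : Prop :=
  A.Nonempty ∧ A ⊆ M ∧ IsCompact A ∧
  (∀ x ∈ A, x ∈ closure (A \ {x})) ∧
  (∀ x ∈ A, ∃ U : Set N, IsOpen U ∧ x ∈ U ∧
    ∃ F : Set (N → ℂ), (∀ f ∈ F, MDifferentiableOn 𝓘(ℂ, H) 𝓘(ℂ, ℂ) f U) ∧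
      A ∩ U = {y ∈ U | ∀ f ∈ F, f y = 0})

/-- `C_M`: the union of all compact complex subvarieties of `M` of complex
dimension `≥ 1`. -/
def varietyUnion (H : Type*) [NormedAddCommGroup H] [NormedSpace ℂ H]
    {N : Type*} [TopologicalSpace N] [ChartedSpace H N] (M : Set N) : Set N :=
  ⋃₀ {A : Set N | IsCompactPosDimSubvariety H M A}

/-- The inclusion `M ↪ N` induces an isomorphism of fundamental groups
(`π₁(M) = π₁(N)`): every loop in `N` based at a point of `M` is homotopic to a loop in
`M`, and loops in `M` which are homotopic in `N` are homotopic in `M`. -/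
def InducesPi1Iso {N : Type*} [TopologicalSpace N] (M : Set N) : Prop :=
  ∀ x₀ : M,
    (∀ γ : Path (x₀ : N) (x₀ : N),
      ∃ δ : Path x₀ x₀, Path.Homotopic γ (δ.map continuous_subtype_val)) ∧
    (∀ δ δ' : Path x₀ x₀,
      Path.Homotopic (δ.map continuous_subtype_val) (δ'.map continuous_subtype_val) →
      Path.Homotopic δ δ')

/-- A closed complex submanifold `Y` of an open set `V`: `Y ⊆ V` is closed in `V` and
is locally the zero set of a holomorphic submersion into some `ℂ^k`. -/
def IsClosedComplexSubmanifoldIn (H : Type*) [NormedAddCommGroup H] [NormedSpace ℂ H]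
    {N : Type*} [TopologicalSpace N] [ChartedSpace H N] (V Y : Set N) : Prop :=
  Y ⊆ V ∧ closure Y ∩ V ⊆ Y ∧
  ∀ y ∈ Y, ∃ (k : ℕ) (U : Set N) (f : N → (Fin k → ℂ)),
    IsOpen U ∧ y ∈ U ∧ U ⊆ V ∧
    MDifferentiableOn 𝓘(ℂ, H) 𝓘(ℂ, Fin k → ℂ) f U ∧
    Y ∩ U = {x ∈ U | f x = 0} ∧
    ∀ x ∈ Y ∩ U, Function.Surjective (mfderiv 𝓘(ℂ, H) 𝓘(ℂ, Fin k → ℂ) f x)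

/-- **Banach–Steinhaus for `O`-estimates.** A family of continuous linear maps on a Banach space
which is pointwise `O(f)` along a countably generated filter is `O(f)` in operator norm. -/
theorem isBigO_of_forall_isBigO_apply {𝕜 α E F : Type*} [RCLike 𝕜]
    [NormedAddCommGroup E] [NormedSpace 𝕜 E] [CompleteSpace E]
    [NormedAddCommGroup F] [NormedSpace 𝕜 F]
    {l : Filter α} [l.IsCountablyGenerated] {L : α → E →L[𝕜] F} {f : α → ℝ}
    (h : ∀ v, (fun x => L x v) =O[l] f) : L =O[l] f := by
  obtain ⟨U, hU⟩ := l.exists_antitone_basis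
  by_contra hcon
  have hfreq : ∀ k : ℕ, ∃ x ∈ U k, (k : ℝ) * ‖f x‖ < ‖L x‖ := by
    intro k
    by_contra! hk
    exact hcon (Asymptotics.IsBigO.of_bound k (Filter.mem_of_superset (hU.mem k) hk))
  choose x hxU hx using hfreq
  have hxl : Filter.Tendsto x Filter.atTop l := hU.tendsto hxU
  have hpos : ∀ k, 0 < ‖L (x k)‖ := fun k => lt_of_le_of_lt (by positivity) (hx k)
  obtain ⟨C, hC⟩ := banach_steinhaus
    (g := fun k : ℕ => (((k : ℝ) / ‖L (x k)‖ : ℝ) : 𝕜) • L (x k)) (by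
      intro v
      obtain ⟨C, hCpos, hC⟩ := (h v).exists_pos
      have hb : ∀ᶠ k : ℕ in Filter.atTop,
          ‖((((k : ℝ) / ‖L (x k)‖ : ℝ) : 𝕜) • L (x k)) v‖ ≤ C := by
        filter_upwards [hxl.eventually hC.bound] with k hk
        rw [smul_apply, norm_smul, RCLike.norm_ofReal,
          abs_of_nonneg (by positivity), div_mul_eq_mul_div, div_le_iff₀ (hpos k)]
        calc (k : ℝ) * ‖L (x k) v‖ ≤ k * (C * ‖f (x k)‖) := by gcongr
          _ = C * (k * ‖f (x k)‖) := by ring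
          _ ≤ C * ‖L (x k)‖ := by gcongr; exact (hx _).le
      obtain ⟨D, hD⟩ := (Filter.isBoundedUnder_of_eventually_le hb).bddAbove_range
      exact ⟨D, fun k => hD ⟨k, rfl⟩⟩)
  obtain ⟨k, hk⟩ := exists_nat_gt C
  have := hC k
  rw [norm_smul, RCLike.norm_ofReal, abs_of_nonneg (by positivity),
    div_mul_cancel₀ _ (hpos k).ne'] at this
  linarith

/-- Parseval's identity for a functional on `ℓ²`. -/
theorem hasSum_norm_apply_single_sq {ι : Type*} [DecidableEq ι] (L : lp (fun _ : ι => ℂ) 2 →L[ℂ] ℂ) :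
    HasSum (fun i => ‖L (lp.single 2 i 1)‖ ^ 2) (‖L‖ ^ 2) := by
  set v := (InnerProductSpace.toDual ℂ (lp (fun _ : ι => ℂ) 2)).symm L with hv
  have h1 : ∀ i, ‖L (lp.single 2 i 1)‖ = ‖v i‖ := by
    intro i
    rw [← InnerProductSpace.toDual_symm_apply, ← hv, lp.inner_single_right]
    simp
  have h2 : ‖L‖ = ‖v‖ := by rw [hv, LinearIsometryEquiv.norm_map]
  simp_rw [h1, h2]
  simpa using lp.hasSum_norm (p := 2) (by simp) v

/-- The quadratic form `L ↦ ∑ bᵢ L(eᵢ)²` on the dual of `ℓ²` converges absolutely and is bounded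
by `sup |b|`. -/
theorem summable_norm_mul_apply_single_sq {ι : Type*} [DecidableEq ι] {b : ι → ℂ} {K : ℝ} (hb : ∀ i, ‖b i‖ ≤ K)
    (L : lp (fun _ : ι => ℂ) 2 →L[ℂ] ℂ) :
    Summable (fun i => b i * L (lp.single 2 i 1) ^ 2) ∧
      ‖∑' i, b i * L (lp.single 2 i 1) ^ 2‖ ≤ K * ‖L‖ ^ 2 := by
  have hs := (hasSum_norm_apply_single_sq L).mul_left K
  have hle : ∀ i, ‖b i * L (lp.single 2 i 1) ^ 2‖ ≤ K * ‖L (lp.single 2 i 1)‖ ^ 2 := by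
    intro i
    rw [norm_mul, norm_pow]
    exact mul_le_mul_of_nonneg_right (hb i) (by positivity)
  exact ⟨.of_norm_bounded hs.summable hle, tsum_of_norm_bounded hs hle⟩

/-- If a family of functionals on `ℓ²` is weakly differentiable at a point, then so is every
bounded diagonal quadratic form in it. -/
theorem differentiableAt_tsum_mul_apply_single_sq {ι X : Type*} [DecidableEq ι] [NormedAddCommGroup X]
    [NormedSpace ℂ X] {b : ι → ℂ} {K : ℝ} (hb : ∀ i, ‖b i‖ ≤ K)
    {L : X → lp (fun _ : ι => ℂ) 2 →L[ℂ] ℂ} {x₀ : X}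
    (hL : ∀ v, DifferentiableAt ℂ (fun x => L x v) x₀) :
    DifferentiableAt ℂ (fun x => ∑' i, b i * L x (lp.single 2 i 1) ^ 2) x₀ := by
  have hmem : Memℓp (fun i => b i * L x₀ (lp.single 2 i 1)) 2 := by
    apply memℓp_gen
    refine .of_norm_bounded ((hasSum_norm_apply_single_sq (L x₀)).summable.mul_left (K ^ 2)) ?_
    intro i
    have : ‖b i * L x₀ (lp.single 2 i 1)‖ ^ 2 ≤ K ^ 2 * ‖L x₀ (lp.single 2 i 1)‖ ^ 2 := by
      rw [norm_mul, mul_pow]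
      gcongr
      exact hb i
    simpa using this
  let v : lp (fun _ : ι => ℂ) 2 := ⟨_, hmem⟩
  have hsingle : ∀ (D : lp (fun _ : ι => ℂ) 2 →L[ℂ] ℂ),
      HasSum (fun i => b i * L x₀ (lp.single 2 i 1) * D (lp.single 2 i 1)) (D v) := by
    intro D
    convert (lp.hasSum_single (by simp) v).mapL D using 1
    funext i
    have : lp.single 2 i (v i) = v i • lp.single (E := fun _ : ι => ℂ) 2 i 1 := by
      rw [← lp.single_smul, smul_eq_mul, mul_one]
    rw [this, map_smul, smul_eq_mul]
  have hexp : (fun x => ∑' i, b i * L x (lp.single 2 i 1) ^ 2) = fun x =>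
      (∑' i, b i * L x₀ (lp.single 2 i 1) ^ 2) + 2 * (L x v - L x₀ v) +
        ∑' i, b i * (L x - L x₀) (lp.single 2 i 1) ^ 2 := by
    funext x
    refine (HasSum.tsum_eq ?_)
    have h := (((summable_norm_mul_apply_single_sq hb (L x₀)).1.hasSum.add
      ((hsingle (L x - L x₀)).mul_left 2)).add
      (summable_norm_mul_apply_single_sq hb (L x - L x₀)).1.hasSum)
    convert h using 1
    · funext i
      simp only [sub_apply]
      ring
    · rw [sub_apply]
  have hO : (fun x => L x - L x₀) =O[𝓝 x₀] fun x => ‖x - x₀‖ :=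
    isBigO_of_forall_isBigO_apply fun w => (hL w).isBigO_sub.norm_right
  have hR : HasFDerivAt (fun x => ∑' i, b i * (L x - L x₀) (lp.single 2 i 1) ^ 2)
      (0 : X →L[ℂ] ℂ) x₀ := by
    have h1 : (fun x => ∑' i, b i * (L x - L x₀) (lp.single 2 i 1) ^ 2) =O[𝓝 x₀]
        fun x => ‖x - x₀‖ ^ 2 := by
      refine .trans (.of_bound K (.of_forall fun x => ?_)) (hO.norm_left.pow 2)
      simpa using (summable_norm_mul_apply_single_sq hb (L x - L x₀)).2
    exact h1.hasFDerivAt one_lt_two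
  rw [hexp]
  exact (((hL v).sub_const _).const_mul 2).const_add _ |>.add hR.differentiableAt

/-- Manifold version of `differentiableAt_tsum_mul_apply_single_sq`. -/
theorem mdifferentiableAt_tsum_mul_apply_single_sq {ι H N : Type*} [DecidableEq ι]
    [NormedAddCommGroup H] [NormedSpace ℂ H] [TopologicalSpace N] [ChartedSpace H N] {b : ι → ℂ} {K : ℝ}
    (hb : ∀ i, ‖b i‖ ≤ K) {L : N → lp (fun _ : ι => ℂ) 2 →L[ℂ] ℂ} {w : N}
    (hL : ∀ v, MDifferentiableAt 𝓘(ℂ, H) 𝓘(ℂ, ℂ) (fun x => L x v) w) :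
    MDifferentiableAt 𝓘(ℂ, H) 𝓘(ℂ, ℂ) (fun x => ∑' i, b i * L x (lp.single 2 i 1) ^ 2) w := by
  have hd : DifferentiableAt ℂ ((fun x => ∑' i, b i * L x (lp.single 2 i 1) ^ 2) ∘
      (chartAt H w).symm) (chartAt H w w) := by
    refine differentiableAt_tsum_mul_apply_single_sq (L := fun y => L ((chartAt H w).symm y))
      hb fun v => ?_
    have := ((mdifferentiableAt_iff _ _).1 (hL v)).2
    rw [ModelWithCorners.range_eq_univ, differentiableWithinAt_univ] at this
    exact this
  refine (mdifferentiableAt_iff _ _).2 ⟨?_, ?_⟩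
  · have hc := hd.continuousAt.comp ((chartAt H w).continuousAt (mem_chart_source H w))
    refine hc.congr ?_
    filter_upwards [chart_source_mem_nhds H w] with x hx
    simp [(chartAt H w).left_inv hx]
  · rw [ModelWithCorners.range_eq_univ, differentiableWithinAt_univ]
    exact hd

/-- The isometric embedding of `ℓ²` of the fibre over `z` onto the functions in `l_{2,ψ,z}`
vanishing off the fibre; it maps the standard basis to the basis `e_s`. -/
def fibExt {N N' : Type*} (r : N' → N) (ψ : N' → ℝ) (z : N) :
    lp (fun _ : r ⁻¹' {z} => ℂ) 2 →ₗ[ℂ] (N' → ℂ) where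
  toFun b y := if hy : y ∈ r ⁻¹' {z} then b ⟨y, hy⟩ * ((ψ y ^ (-(1 / 2) : ℝ) : ℝ) : ℂ) else 0
  map_add' b b' := by
    funext y
    by_cases hy : y ∈ r ⁻¹' {z}
    · simp only [hy, dif_pos, Pi.add_apply, lp.coeFn_add]; ring
    · simp only [hy, dif_neg, not_false_eq_true, Pi.add_apply, add_zero]
  map_smul' c b := by
    funext y
    by_cases hy : y ∈ r ⁻¹' {z}
    · simp only [hy, dif_pos, Pi.smul_apply, lp.coeFn_smul, smul_eq_mul, RingHom.id_apply]; ring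
    · simp only [hy, dif_neg, not_false_eq_true, Pi.smul_apply, smul_zero]

section fibExt

variable {N N' : Type*} {r : N' → N} {ψ : N' → ℝ} {z : N}

theorem fibExt_single (s : r ⁻¹' {z}) :
    fibExt r ψ z (lp.single 2 s 1) =
      fun y => if y = ↑s then (((ψ ↑s) ^ (-(1/2) : ℝ) : ℝ) : ℂ) else 0 := by
  funext y
  by_cases hy : y ∈ r ⁻¹' {z}
  · by_cases hys : y = ↑s
    · subst hys
      simp only [fibExt, LinearMap.coe_mk, AddHom.coe_mk, dif_pos hy, if_true, Subtype.coe_eta,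
        lp.single_apply_self, one_mul]
    · have hne : (⟨y, hy⟩ : r ⁻¹' {z}) ≠ s := fun h => hys (congrArg Subtype.val h)
      simp [fibExt, hys, hne]
  · have hys : y ≠ ↑s := fun h => hy (h ▸ s.2)
    simp only [fibExt, LinearMap.coe_mk, AddHom.coe_mk, dif_neg hy, if_neg hys]

theorem sq_rpow_neg_half_mul {t : ℝ} (ht : 0 < t) : (t ^ (-(1 / 2) : ℝ)) ^ 2 * t = 1 := by
  rw [← Real.rpow_natCast, ← Real.rpow_mul ht.le]
  norm_num
  rw [Real.rpow_neg_one, inv_mul_cancel₀ ht.ne']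

theorem norm_fibExt_rpow_mul (hψ : ∀ y, 0 < ψ y) (b : lp (fun _ : r ⁻¹' {z} => ℂ) 2)
    (y : r ⁻¹' {z}) :
    ‖fibExt r ψ z b ↑y‖ ^ (2 : ℝ≥0∞).toReal * ψ ↑y = ‖b y‖ ^ (2 : ℝ≥0∞).toReal := by
  have h : fibExt r ψ z b ↑y = b y * ((ψ y ^ (-(1 / 2) : ℝ) : ℝ) : ℂ) := dif_pos y.2
  rw [h, norm_mul, Complex.norm_real, Real.norm_eq_abs, abs_of_nonneg (Real.rpow_nonneg (hψ _).le _)]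
  simp only [ENNReal.toReal_ofNat, Real.rpow_ofNat]
  rw [mul_pow, mul_assoc, sq_rpow_neg_half_mul (hψ _), mul_one]

theorem memFibLp_fibExt (hψ : ∀ y, 0 < ψ y) (b : lp (fun _ : r ⁻¹' {z} => ℂ) 2) :
    MemFibLp r ψ 2 z (fibExt r ψ z b) := by
  rw [MemFibLp, if_neg (by simp)]
  simp_rw [norm_fibExt_rpow_mul hψ]
  exact (lp.memℓp b).summable (by simp)

theorem fibLpNorm_fibExt (hψ : ∀ y, 0 < ψ y) (b : lp (fun _ : r ⁻¹' {z} => ℂ) 2) :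
    fibLpNorm r ψ 2 z (fibExt r ψ z b) = ‖b‖ := by
  rw [fibLpNorm, if_neg (by simp)]
  simp_rw [norm_fibExt_rpow_mul hψ]
  exact (lp.norm_eq_tsum_rpow (by simp) b).symm

end fibExt

/-- Point evaluations on `H_{2,ψ}(M')` are bounded. -/
theorem norm_mul_sqrt_le_covHpNorm {H N N' : Type*} [NormedAddCommGroup H] [NormedSpace ℂ H]
    [TopologicalSpace N] [ChartedSpace H N] [TopologicalSpace N'] [ChartedSpace H N']
    {r : N' → N} {ψ : N' → ℝ} (hψ : ∀ y, 0 < ψ y) {M : Set N} {g : N' → ℂ}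
    (hg : MemCovHp H r ψ 2 M g) {u : N'} (hu : r u ∈ M) :
    ‖g u‖ * √(ψ u) ≤ covHpNorm r ψ 2 M g := by
  refine le_trans ?_ (le_ciSup hg.2.2 ⟨r u, hu⟩)
  have hs := hg.2.1 _ hu
  rw [MemFibLp, if_neg (by simp)] at hs
  rw [fibLpNorm, if_neg (by simp)]
  have h := hs.le_tsum ⟨u, rfl⟩ fun y _ => mul_nonneg (by positivity) (hψ _).le
  simp only [ENNReal.toReal_ofNat, Real.rpow_ofNat, ← Real.sqrt_eq_rpow] at h ⊢
  apply Real.le_sqrt_of_sq_le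
  rwa [mul_pow, Real.sq_sqrt (hψ _).le]

/-- **The operator (2.4) for `p = ∞`.** Fix `z ∈ M \ C_M`, let `{e_s}` be the
orthonormal basis of `l_{2,ψ,z}(M')`, `h_{s,z} := T_{ψ,z}(e_s)` for a bounded linear
interpolation operator `T_{ψ,z}` of norm `c` for `p = 2`, `F_{s,z} := ψ(s)·h_{s,z}²`,
and define `T̃_{ψ,z}(a) := Σ_s a_s F_{s,z}`.  Then `T̃_{ψ,z}` maps `l_{∞,ψ,z}(M')`
boundedly into `H_{∞,ψ}(M')` with norm at most `c²` and `(T̃_{ψ,z} a)(x) = a(x)` on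
the fibre over `z`; i.e. it is a bounded linear interpolation operator for `p = ∞`. -/
theorem tilde_operator_interpolates_p_infty
    (n : ℕ)
    {N : Type*} [TopologicalSpace N] [ChartedSpace (Fin n → ℂ) N]
    {N' : Type*} [MetricSpace N'] [ChartedSpace (Fin n → ℂ) N']
    (r : N' → N) (hr : IsCoveringMap r)
    (hrholo : MDifferentiable 𝓘(ℂ, Fin n → ℂ) 𝓘(ℂ, Fin n → ℂ) r)
    (M : Set N) (hM : IsStronglyPseudoconvexDomain (Fin n → ℂ) M)
    (ψ : N' → ℝ) (hψpos : ∀ y, 0 < ψ y)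
    (hψuc : UniformContinuous fun y => Real.log (ψ y))
    (z : N) (hz : z ∈ M \ varietyUnion (Fin n → ℂ) M)
    -- `T` is a bounded linear interpolation operator of norm `c` for `p = 2`
    (T : (N' → ℂ) → (N' → ℂ)) (c : ℝ) (hc : 0 ≤ c)
    (hTadd : ∀ h₁ h₂ : N' → ℂ, T (h₁ + h₂) = T h₁ + T h₂)
    (hTsmul : ∀ (a : ℂ) (h : N' → ℂ), T (a • h) = a • T h)
    (hT : ∀ h : N' → ℂ, MemFibLp r ψ 2 z h →
      MemCovHp (Fin n → ℂ) r ψ 2 M (T h) ∧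
      covHpNorm r ψ 2 M (T h) ≤ c * fibLpNorm r ψ 2 z h ∧
      ∀ x ∈ r ⁻¹' {z}, T h x = h x)
    -- `F_{s,z}(w) = ψ(z,s) h_{s,z}(w)²` where `h_{s,z} = T(e_s)`
    (F : r ⁻¹' {z} → N' → ℂ)
    (hF : ∀ (s : r ⁻¹' {z}) (w : N'),
      F s w = (ψ ↑s : ℂ) *
        (T (fun y => if y = ↑s then (((ψ ↑s) ^ (-(1/2) : ℝ) : ℝ) : ℂ) else 0) w) ^ 2)
    -- `T̃(a) = Σ_s a_s F_{s,z}`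
    (Tt : (N' → ℂ) → (N' → ℂ))
    (hTt : ∀ (a : N' → ℂ) (w : N'), Tt a w = ∑' s : r ⁻¹' {z}, a ↑s * F s w) :
    ∀ a : N' → ℂ, MemFibLp r ψ ∞ z a →
      MemCovHp (Fin n → ℂ) r ψ ∞ M (Tt a) ∧
      covHpNorm r ψ ∞ M (Tt a) ≤ c ^ 2 * fibLpNorm r ψ ∞ z a ∧
      ∀ x ∈ r ⁻¹' {z}, Tt a x = a x := by
  intro a ha
  let T' : (N' → ℂ) →ₗ[ℂ] (N' → ℂ) := ⟨⟨T, hTadd⟩, hTsmul⟩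
  have hTE : ∀ b, _ := fun b => hT _ (memFibLp_fibExt (r := r) (z := z) hψpos b)
  have hbound : ∀ u ∈ r ⁻¹' M, ∀ b : lp (fun _ : r ⁻¹' {z} => ℂ) 2,
      ‖T (fibExt r ψ z b) u‖ ≤ c / √(ψ u) * ‖b‖ := by
    intro u hu b
    have h1 := (norm_mul_sqrt_le_covHpNorm hψpos (hTE b).1 hu).trans (hTE b).2.1
    rw [fibLpNorm_fibExt hψpos] at h1
    rw [div_mul_eq_mul_div]
    exact (le_div_iff₀ (Real.sqrt_pos.2 (hψpos u))).2 h1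
  let L : N' → lp (fun _ : r ⁻¹' {z} => ℂ) 2 →L[ℂ] ℂ := fun u =>
    if hu : u ∈ r ⁻¹' M then
      (LinearMap.proj u ∘ₗ T' ∘ₗ fibExt r ψ z).mkContinuous (c / √(ψ u)) (hbound u hu)
    else 0
  have hL : ∀ u ∈ r ⁻¹' M, ∀ b, L u b = T (fibExt r ψ z b) u := by
    intro u hu b
    simp only [L, dif_pos hu]
    rfl
  have hLnorm : ∀ u ∈ r ⁻¹' M, ‖L u‖ ^ 2 * ψ u ≤ c ^ 2 := by
    intro u hu
    have hle : ‖L u‖ ≤ c / √(ψ u) :=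
      (L u).opNorm_le_bound (by positivity) fun b => by rw [hL u hu]; exact hbound u hu b
    calc ‖L u‖ ^ 2 * ψ u ≤ (c / √(ψ u)) ^ 2 * ψ u := by
          have := (hψpos u).le
          gcongr
      _ = c ^ 2 := by
          rw [div_pow, Real.sq_sqrt (hψpos u).le, div_mul_cancel₀ _ (hψpos u).ne']
  set A := fibLpNorm r ψ ∞ z a with hA
  rw [MemFibLp, if_pos rfl] at ha
  rw [fibLpNorm, if_pos rfl] at hA
  have hA0 : 0 ≤ A := hA ▸ Real.iSup_nonneg fun y => mul_nonneg (norm_nonneg _) (hψpos _).le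
  have hb : ∀ s : r ⁻¹' {z}, ‖a ↑s * (ψ ↑s : ℂ)‖ ≤ A := by
    intro s
    rw [norm_mul, Complex.norm_real, Real.norm_eq_abs, abs_of_pos (hψpos _), hA]
    exact le_ciSup ha s
  have hTtL : ∀ u ∈ r ⁻¹' M,
      Tt a u = ∑' s : r ⁻¹' {z}, a ↑s * (ψ ↑s : ℂ) * L u (lp.single 2 s 1) ^ 2 := by
    intro u hu
    rw [hTt]
    refine tsum_congr fun s => ?_
    rw [hF, hL u hu, fibExt_single, mul_assoc]
  have hpt : ∀ u ∈ r ⁻¹' M, ‖Tt a u‖ * ψ u ≤ c ^ 2 * A := by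
    intro u hu
    rw [hTtL u hu]
    calc _ ≤ A * ‖L u‖ ^ 2 * ψ u :=
          mul_le_mul_of_nonneg_right (summable_norm_mul_apply_single_sq hb (L u)).2 (hψpos u).le
      _ = A * (‖L u‖ ^ 2 * ψ u) := by ring
      _ ≤ A * c ^ 2 := by gcongr; exact hLnorm u hu
      _ = c ^ 2 * A := mul_comm _ _
  have hfib : ∀ x ∈ M, ∀ y : r ⁻¹' {x}, ‖Tt a ↑y‖ * ψ ↑y ≤ c ^ 2 * A := by
    rintro x hx ⟨y, rfl⟩
    exact hpt y hx
  have hfibnorm : ∀ x : M, fibLpNorm r ψ ∞ ↑x (Tt a) ≤ c ^ 2 * A := by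
    intro x
    rw [fibLpNorm, if_pos rfl]
    exact Real.iSup_le (hfib x x.2) (by positivity)
  have hopen : IsOpen (r ⁻¹' M) := hM.1.preimage hr.continuous
  refine ⟨⟨?_, ?_, ⟨_, Set.forall_mem_range.2 hfibnorm⟩⟩, Real.iSup_le hfibnorm (by positivity), ?_⟩
  · intro w hw
    have hnhds := hopen.mem_nhds hw
    refine MDifferentiableAt.mdifferentiableWithinAt ?_
    refine (mdifferentiableAt_tsum_mul_apply_single_sq hb (L := L) fun v => ?_).congr_of_eventuallyEq
      (Filter.mem_of_superset hnhds fun u hu => hTtL u hu)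
    exact ((hTE v).1.1.mdifferentiableAt hnhds).congr_of_eventuallyEq
      (Filter.mem_of_superset hnhds fun u hu => hL u hu v)
  · intro x hx
    rw [MemFibLp, if_pos rfl]
    exact ⟨_, Set.forall_mem_range.2 (hfib x hx)⟩
  · intro x hx
    have hxM : x ∈ r ⁻¹' M := by
      have : r x = z := hx
      simpa [this] using hz.1
    have hval : ∀ s : r ⁻¹' {z}, L x (lp.single 2 s 1) =
        if x = ↑s then (((ψ ↑s) ^ (-(1/2) : ℝ) : ℝ) : ℂ) else 0 := by
      intro s
      rw [hL x hxM, (hTE _).2.2 x hx, fibExt_single]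
    rw [hTtL x hxM, tsum_eq_single ⟨x, hx⟩]
    · rw [hval, if_pos rfl, mul_assoc, mul_comm ((ψ x : ℝ) : ℂ)]
      norm_cast
      rw [sq_rpow_neg_half_mul (hψpos x)]
      simp
    · intro s hs
      have hne : x ≠ ↑s := fun h => hs (Subtype.ext h.symm)
      rw [hval, if_neg hne]
      simp

end
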